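/- Fix an integer k ≥ 2, let G=(V,E) be a finite simple graph, and let L be a sequence of moves for max-k-cut that is improving from an initial configuration τ_0 : V → [k] with respect to some edge weights X ∈ [−1,1]^E. Then rank(P_{L,τ_0}) ≥ c(L)/2, where c(L) is the number of cyclic vertices of L. -/

import Mathlib

open Finset MeasureTheory ProbabilityTheory Filter
open scoped Classical

/-- Edges of the complete graph on `n` vertices: ordered pairs `(a,b)` with `a < b`. -/
abbrev mcEdge (n : ℕ) := {e : Fin n × Fin n // e.1 < e.2}

/-- A move `(v,p,q)` for max-`k`-cut: vertex `v` moves from part `p` to part `q`. -/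
abbrev KMove (n k : ℕ) := Fin n × Fin k × Fin k

/-- The inner product `⟨σ(i),σ(j)⟩` of the unit simplex vectors: `1` if `i = j`
and `−1/(k−1)` otherwise. -/
noncomputable def sigmaDot (k : ℕ) (i j : Fin k) : ℝ :=
  if i = j then 1 else -(1 / ((k : ℝ) - 1))

/-- Performing the move `m = (v,p,q)`: vertex `v` is placed in part `q`. -/
def kStep {n k : ℕ} (τ : Fin n → Fin k) (m : KMove n k) : Fin n → Fin k :=
  Function.update τ m.1 m.2.2

/-- The configuration reached from `τ` after performing all moves of `L`. -/
def kRun {n k : ℕ} (τ : Fin n → Fin k) : List (KMove n k) → (Fin n → Fin k)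
  | [] => τ
  | m :: L => kRun (kStep τ m) L

/-- `L` is a valid sequence of moves from `τ`: each move `(v,p,q)` has `p ≠ q` and is
applied when `τ(v) = p`. -/
def kValid {n k : ℕ} : (Fin n → Fin k) → List (KMove n k) → Prop
  | _, [] => True
  | τ, m :: L => τ m.1 = m.2.1 ∧ m.2.1 ≠ m.2.2 ∧ kValid (kStep τ m) L

/-- The configuration `τ_t` after the first `t` moves of `L`. -/
def kConfAt {n k : ℕ} (τ0 : Fin n → Fin k) (L : List (KMove n k)) (t : ℕ) : Fin n → Fin k :=
  kRun τ0 (L.take t)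

/-- The entry `M_{L,τ0}[{a,b},t]` of the matrix `M` for max-`k`-cut. -/
noncomputable def kM {n k : ℕ} (L : List (KMove n k)) (τ0 : Fin n → Fin k) (a b : Fin n)
    (t : Fin L.length) : ℚ :=
  if (a = (L.get t).1 ∧ (L.get t).2.2 = kConfAt τ0 L (t + 1) b) ∨
     (b = (L.get t).1 ∧ (L.get t).2.2 = kConfAt τ0 L (t + 1) a) then 1
  else if (a = (L.get t).1 ∧ (L.get t).2.1 = kConfAt τ0 L (t + 1) b) ∨
     (b = (L.get t).1 ∧ (L.get t).2.1 = kConfAt τ0 L (t + 1) a) then -1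
  else 0

/-- The set of time steps `T` is a circuit over the vertex `v` in `L`: all moves at times of
`T` are moves of `v`, consecutive moves (in increasing order of time) match up
(`q_{t_i} = p_{t_{i+1}}`), and the last move returns to the starting part
(`q_{t_w} = p_{t_1}`). -/
def IsCircuit {n k : ℕ} (L : List (KMove n k)) (v : Fin n)
    (T : Finset (Fin L.length)) : Prop :=
  T.Nonempty ∧ (∀ t ∈ T, (L.get t).1 = v) ∧
  List.Chain' (fun a b => (L.get a).2.2 = (L.get b).2.1) (T.sort (· ≤ ·)) ∧
  ∀ h : T.Nonempty, (L.get (T.max' h)).2.2 = (L.get (T.min' h)).2.1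

/-- A cycle is an inclusion-wise minimal circuit. -/
def IsCycle {n k : ℕ} (L : List (KMove n k)) (v : Fin n)
    (T : Finset (Fin L.length)) : Prop :=
  IsCircuit L v T ∧ ∀ T' ⊂ T, ¬ IsCircuit L v T'

/-- The set `Γ(L)` of cycles of `L`, as a type: a vertex together with the set of time
steps of a cycle over it. -/
abbrev KCycle {n k : ℕ} (L : List (KMove n k)) :=
  {c : Fin n × Finset (Fin L.length) // IsCycle L c.1 c.2}

/-- The entry `P_{L,τ0}[{a,b},C] = ∑_{t ∈ T(C)} M_{L,τ0}[{a,b},t]`. -/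
noncomputable def kPval {n k : ℕ} (L : List (KMove n k)) (τ0 : Fin n → Fin k)
    (a b : Fin n) (T : Finset (Fin L.length)) : ℚ :=
  ∑ t ∈ T, kM L τ0 a b t

/-- The set `S(L)` of vertices appearing in `L`. -/
def kS {n k : ℕ} (L : List (KMove n k)) : Finset (Fin n) := (L.map Prod.fst).toFinset

/-- The set `C(L)` of cyclic vertices of `L`: vertices over which some cycle of `L` lies. -/
noncomputable def cyclicSet {n k : ℕ} (L : List (KMove n k)) : Finset (Fin n) :=
  Finset.univ.filter (fun v => ∃ T, IsCycle L v T)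

/-- The set `A(L)` of acyclic vertices of `L`: vertices of `L` that are not cyclic. -/
noncomputable def acyclicSet {n k : ℕ} (L : List (KMove n k)) : Finset (Fin n) :=
  kS L \ cyclicSet L

/-- Edges of the graph `G`: ordered pairs `(a,b)` with `a < b` and `a` adjacent to `b`. -/
abbrev gEdge {n : ℕ} (G : SimpleGraph (Fin n)) := {e : Fin n × Fin n // e.1 < e.2 ∧ G.Adj e.1 e.2}

/-- The max-`k`-cut Hamiltonian
`H(τ) = −((k−1)/k)·∑_{{u,v} ∈ E} X_{uv} ⟨σ(τ(u)),σ(τ(v))⟩` on the graph `G`. -/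
noncomputable def kH {n k : ℕ} (G : SimpleGraph (Fin n)) (X : gEdge G → ℝ)
    (τ : Fin n → Fin k) : ℝ :=
  -(((k : ℝ) - 1) / (k : ℝ)) * ∑ e : gEdge G, X e * sigmaDot k (τ e.1.1) (τ e.1.2)

/-- `L` is an improving sequence from `τ` with respect to `X`: it is valid from `τ` and
every move strictly increases the Hamiltonian. -/
def kImproving {n k : ℕ} (G : SimpleGraph (Fin n)) (X : gEdge G → ℝ) :
    (Fin n → Fin k) → List (KMove n k) → Prop
  | _, [] => True
  | τ, m :: L => τ m.1 = m.2.1 ∧ m.2.1 ≠ m.2.2 ∧ kH G X τ < kH G X (kStep τ m) ∧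
      kImproving G X (kStep τ m) L

/-- The matrix `P_{L,τ0}` with rows indexed by the edges of `G` and columns indexed by the
cycles of `L`. -/
noncomputable def kP {n k : ℕ} (G : SimpleGraph (Fin n)) (L : List (KMove n k))
    (τ0 : Fin n → Fin k) : Matrix (gEdge G) (KCycle L) ℚ :=
  fun e c => kPval L τ0 e.1.1 e.1.2 c.1.2

/-- A matrix with a square submatrix that is triangular with nonzero diagonal has rank at
least the size of that submatrix. -/
theorem Matrix.card_le_rank_of_triangular {m n ι K : Type*} [Field K] [Fintype m] [Fintype n]
    [Fintype ι] [LinearOrder ι] (A : Matrix m n K) (r : ι → m) (c : ι → n)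
    (hdiag : ∀ i, A (r i) (c i) ≠ 0) (htri : ∀ i j, i < j → A (r i) (c j) = 0) :
    Fintype.card ι ≤ A.rank := by
  have hdet : IsUnit (A.submatrix r c).det := by
    rw [Matrix.det_of_isLowerTriangular (A.submatrix r c) fun i j hij => htri i j hij]
    exact isUnit_iff_ne_zero.2 (Finset.prod_ne_zero_iff.2 fun i _ => hdiag i)
  rw [← Matrix.rank_of_isUnit _ ((Matrix.isUnit_iff_isUnit_det _).2 hdet)]
  exact Matrix.rank_submatrix_le _ _ _

theorem kConfAt_succ {n k : ℕ} (τ : Fin n → Fin k) (L : List (KMove n k)) (t : Fin L.length) :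
    kConfAt τ L (t + 1) = kStep (kConfAt τ L t) (L.get t) := by
  induction L generalizing τ with
  | nil => exact t.elim0
  | cons m L ih =>
    refine Fin.cases ?_ (fun s => ?_) t
    · simp [kConfAt, kRun]
    · simpa [kConfAt, kRun] using ih (kStep τ m) s

theorem kImproving.move_spec {n k : ℕ} {G : SimpleGraph (Fin n)} {X : gEdge G → ℝ}
    {τ : Fin n → Fin k} {L : List (KMove n k)} (h : kImproving G X τ L) (t : Fin L.length) :
    kConfAt τ L t (L.get t).1 = (L.get t).2.1 ∧ (L.get t).2.1 ≠ (L.get t).2.2 ∧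
      kH G X (kConfAt τ L t) < kH G X (kConfAt τ L (t + 1)) := by
  induction L generalizing τ with
  | nil => exact t.elim0
  | cons m L ih =>
    obtain ⟨h1, h2, h3, h4⟩ := h
    refine Fin.cases ?_ (fun s => ?_) t
    · simpa [kConfAt, kRun] using ⟨h1, h2, h3⟩
    · simpa [kConfAt, kRun] using ih h4 s

theorem sigmaDot_sub_sigmaDot {k : ℕ} (hk : 2 ≤ k) (i j i' j' : Fin k) :
    ((k : ℝ) - 1) / k * (sigmaDot k i' j' - sigmaDot k i j) =
      (if i' = j' then 1 else 0) - (if i = j then 1 else 0) := by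
  have hk' : (2 : ℝ) ≤ k := by exact_mod_cast hk
  have h0 : (k : ℝ) ≠ 0 := by linarith
  have h1 : (k : ℝ) - 1 ≠ 0 := by linarith
  unfold sigmaDot
  split_ifs <;> field_simp <;> ring

/-- Along a valid move, an entry of `M` records the change of the indicator that the endpoints
of the edge lie in the same part. -/
theorem kM_eq_indicator_sub {n k : ℕ} {L : List (KMove n k)} {τ : Fin n → Fin k}
    {t : Fin L.length} (hp : kConfAt τ L t (L.get t).1 = (L.get t).2.1)
    (hpq : (L.get t).2.1 ≠ (L.get t).2.2) {a b : Fin n} (hab : a ≠ b) :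
    kM L τ a b t =
      (if kConfAt τ L (t + 1) a = kConfAt τ L (t + 1) b then 1 else 0) -
        (if kConfAt τ L t a = kConfAt τ L t b then 1 else 0) := by
  unfold kM
  rw [kConfAt_succ]
  generalize kConfAt τ L t = ρ at *
  generalize L.get t = m at *
  obtain ⟨v, p, q⟩ := m
  simp only [kStep, Function.update_apply] at *
  grind

theorem kH_sub_kH_eq {n k : ℕ} (hk : 2 ≤ k) {G : SimpleGraph (Fin n)} {X : gEdge G → ℝ}
    {L : List (KMove n k)} {τ : Fin n → Fin k} (h : kImproving G X τ L) (t : Fin L.length) :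
    kH G X (kConfAt τ L (t + 1)) - kH G X (kConfAt τ L t) =
      -∑ e : gEdge G, X e * (kM L τ e.1.1 e.1.2 t : ℝ) := by
  obtain ⟨hp, hpq, -⟩ := h.move_spec t
  unfold kH
  rw [← mul_sub, ← Finset.sum_sub_distrib, neg_mul, Finset.mul_sum]
  congr 1
  refine Finset.sum_congr rfl fun e _ => ?_
  rw [← mul_sub, mul_left_comm, sigmaDot_sub_sigmaDot hk, kM_eq_indicator_sub hp hpq e.2.1.ne]
  split_ifs <;> simp

theorem exists_kPval_ne_zero {n k : ℕ} (hk : 2 ≤ k) {G : SimpleGraph (Fin n)}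
    {X : gEdge G → ℝ} {L : List (KMove n k)} {τ : Fin n → Fin k} (h : kImproving G X τ L)
    {T : Finset (Fin L.length)} (hT : T.Nonempty) :
    ∃ e : gEdge G, kPval L τ e.1.1 e.1.2 T ≠ 0 := by
  by_contra! h0
  have hpos : 0 < ∑ t ∈ T, -∑ e : gEdge G, X e * (kM L τ e.1.1 e.1.2 t : ℝ) :=
    Finset.sum_pos (fun t _ => by
      rw [← kH_sub_kH_eq hk h t]
      exact sub_pos.2 (h.move_spec t).2.2) hT
  rw [Finset.sum_neg_distrib, Finset.sum_comm] at hpos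
  simp_rw [← Finset.mul_sum, ← Rat.cast_sum] at hpos
  unfold kPval at h0
  simp [h0] at hpos

theorem eq_or_eq_of_kPval_ne_zero {n k : ℕ} {L : List (KMove n k)} {τ : Fin n → Fin k}
    {a b v : Fin n} {T : Finset (Fin L.length)} (hT : ∀ t ∈ T, (L.get t).1 = v)
    (h : kPval L τ a b T ≠ 0) : v = a ∨ v = b := by
  obtain ⟨t, ht, hne⟩ := Finset.exists_ne_zero_of_sum_ne_zero h
  have hv := hT t ht
  unfold kM at hne
  grind

/-- rank is at least half the number of cyclic vertices.
If `L` is an improving sequence for max-`k`-cut from `τ0` with respect to edge weights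
`X ∈ [−1,1]^E`, then `rank(P_{L,τ0}) ≥ c(L)/2`. -/
theorem rank_ge_half_cyclic {n k : ℕ} (hk : 2 ≤ k)
    (G : SimpleGraph (Fin n)) (X : gEdge G → ℝ)
    (hX : ∀ e, X e ∈ Set.Icc (-1 : ℝ) 1)
    (L : List (KMove n k)) (τ0 : Fin n → Fin k)
    (himp : kImproving G X τ0 L) :
    ((cyclicSet L).card : ℝ) / 2 ≤ ((kP G L τ0).rank : ℝ) := by
  have hcyc (v : {v // v ∈ cyclicSet L}) : ∃ T, IsCycle L v T := (Finset.mem_filter.1 v.2).2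
  choose T hT using hcyc
  choose r hr using fun v => exists_kPval_ne_zero hk himp (hT v).1.1
  let c (v : {v // v ∈ cyclicSet L}) : KCycle L := ⟨(v, T v), hT v⟩
  have hend (u v) (h : kP G L τ0 (r v) (c u) ≠ 0) : u.1 = (r v).1.1 ∨ u.1 = (r v).1.2 :=
    eq_or_eq_of_kPval_ne_zero (hT u).1.2.1 h
  have hfst : Fintype.card {v // v.1 = (r v).1.1} ≤ (kP G L τ0).rank :=
    Matrix.card_le_rank_of_triangular (ι := {v // v.1 = (r v).1.1}ᵒᵈ) _
      (fun v => r v.ofDual.1) (fun v => c v.ofDual.1) (fun v => hr _) fun u v huv => by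
        have huv' : v.ofDual.1.1 < u.ofDual.1.1 := huv
        by_contra h
        have hlt := (r u.ofDual.1).2.1
        have hu := u.ofDual.2
        rcases hend _ _ h with h | h <;> order
  have hsnd : Fintype.card {v // ¬ v.1 = (r v).1.1} ≤ (kP G L τ0).rank :=
    Matrix.card_le_rank_of_triangular _
      (fun v => r v.1) (fun v => c v.1) (fun v => hr _) fun u v huv => by
        have huv' : u.1.1 < v.1.1 := huv
        by_contra h
        have hlt := (r u.1).2.1
        have hu := (hend _ _ (hr u.1)).resolve_left u.2
        rcases hend _ _ h with h | h <;> order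
  have hcard : (cyclicSet L).card ≤ 2 * (kP G L τ0).rank := by
    rw [← Fintype.card_coe, ← Fintype.card_congr (Equiv.sumCompl fun v => v.1 = (r v).1.1),
      Fintype.card_sum]
    omega
  have : ((cyclicSet L).card : ℝ) ≤ 2 * (kP G L τ0).rank := by exact_mod_cast hcard
  linarith
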